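/- arXiv:math/0203059 — 3 statements merged into one kernel-verified Lean document; each statement's English description precedes it below -/
import Mathlib

section
/- Let n ≥ 4 be an integer and s ≥ 2 an integer, and let x_s denote the maximal root of P_s. Then 1 − x_s² ≥ (n−4)²/(2s+n−4)². -/
open Polynomial Set

/-- `IsJacobi α s P` says that `P` is the Jacobi polynomial `P_s^{(α,α)}`:
the unique real polynomial of degree `s` orthogonal to all lower-degree
monomials with respect to the weight `(1 - t²)^α` on `(-1,1)`, normalized by
`P(1) = Γ(s+α+1)/(Γ(α+1)·s!)`. -/
def IsJacobi (α : ℝ) (s : ℕ) (P : Polynomial ℝ) : Prop :=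
  P.degree = (s : ℕ) ∧
  (∀ j < s, (∫ t in (-1 : ℝ)..1, P.eval t * t ^ j * (1 - t ^ 2) ^ α) = 0) ∧
  P.eval 1 = Real.Gamma ((s : ℝ) + α + 1) / (Real.Gamma (α + 1) * (Nat.factorial s : ℝ))

/-- The weight function `w(t) = (1-t²)^{(n-3)/2}`. -/
noncomputable def jWeight (n : ℕ) (t : ℝ) : ℝ := (1 - t ^ 2) ^ (((n : ℝ) - 3) / 2)

/-- `‖P‖₂ = (∫_{-1}^1 P(t)² (1-t²)^{(n-3)/2} dt)^{1/2}`. -/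
noncomputable def jNorm (n : ℕ) (P : Polynomial ℝ) : ℝ :=
  Real.sqrt (∫ t in (-1 : ℝ)..1, (P.eval t) ^ 2 * jWeight n t)

/-- The linear functional `f ↦ ∫_{-1}^1 f(t) (1-t²)^α dt` on polynomials. -/
noncomputable def ultraInt (α : ℝ) (f : ℝ[X]) : ℝ :=
  ∫ t in (-1 : ℝ)..1, f.eval t * (1 - t ^ 2) ^ α

theorem continuous_one_sub_sq_rpow {α : ℝ} (hα : 0 ≤ α) :
    Continuous fun t : ℝ => (1 - t ^ 2) ^ α :=
  Continuous.rpow_const (by fun_prop) fun _ => Or.inr hα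

theorem continuous_eval_mul_weight {α : ℝ} (hα : 0 ≤ α) (f : ℝ[X]) :
    Continuous fun t : ℝ => f.eval t * (1 - t ^ 2) ^ α :=
  f.continuous.mul (continuous_one_sub_sq_rpow hα)

theorem ultraInt_add {α : ℝ} (hα : 0 ≤ α) (f g : ℝ[X]) :
    ultraInt α (f + g) = ultraInt α f + ultraInt α g := by
  unfold ultraInt
  rw [← intervalIntegral.integral_add
    ((continuous_eval_mul_weight hα f).intervalIntegrable _ _)
    ((continuous_eval_mul_weight hα g).intervalIntegrable _ _)]
  simp only [eval_add, add_mul]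

theorem ultraInt_C_mul (α : ℝ) (c : ℝ) (f : ℝ[X]) :
    ultraInt α (C c * f) = c * ultraInt α f := by
  unfold ultraInt
  rw [← intervalIntegral.integral_const_mul]
  simp only [eval_mul, eval_C, mul_assoc]

theorem ultraInt_sub {α : ℝ} (hα : 0 ≤ α) (f g : ℝ[X]) :
    ultraInt α (f - g) = ultraInt α f - ultraInt α g := by
  have h := ultraInt_add hα (f - g) g
  rw [sub_add_cancel] at h
  linarith

/-- Integration by parts against the weight `(1-t²)^α`. -/
theorem ultraInt_by_parts {α : ℝ} (hα : 0 ≤ α) (f : ℝ[X]) :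
    ultraInt α ((1 - X ^ 2) * derivative f - C (2 * (α + 1)) * (X * f)) = 0 := by
  have hd : ∀ t ∈ uIcc (-1 : ℝ) 1, HasDerivAt (fun t : ℝ => f.eval t * (1 - t ^ 2) ^ (α + 1))
      (((1 - X ^ 2) * derivative f - C (2 * (α + 1)) * (X * f)).eval t * (1 - t ^ 2) ^ α) t := by
    intro t ht
    rw [uIcc_of_le (by norm_num)] at ht
    have h0 : 0 ≤ 1 - t ^ 2 := by nlinarith [ht.1, ht.2]
    have h1 : HasDerivAt (fun t : ℝ => 1 - t ^ 2) (-(2 * t)) t := by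
      simpa using (hasDerivAt_pow 2 t).const_sub 1
    have h2 := h1.rpow_const (p := α + 1) (Or.inr (by linarith))
    refine ((f.hasDerivAt t).mul h2).congr_deriv ?_
    rw [Real.rpow_add_one' h0 (by linarith), add_sub_cancel_right]
    simp
    ring
  unfold ultraInt
  rw [intervalIntegral.integral_eq_sub_of_hasDerivAt hd
    ((continuous_eval_mul_weight hα _).intervalIntegrable _ _)]
  have : α + 1 ≠ 0 := by linarith
  simp [Real.zero_rpow this]

theorem eq_zero_of_ultraInt_sq {α : ℝ} (hα : 0 ≤ α) {f : ℝ[X]} (h : ultraInt α (f * f) = 0) :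
    f = 0 := by
  by_contra hf
  have hex : ∃ c ∈ Ioo (-1 : ℝ) 1, f.eval c ≠ 0 := by
    by_contra! hc
    exact hf (Polynomial.eq_zero_of_infinite_isRoot f
      ((Ioo_infinite (by norm_num : (-1 : ℝ) < 1)).mono fun c hcm => hc c hcm))
  obtain ⟨c, hc, hfc⟩ := hex
  have hpos : 0 < ultraInt α (f * f) := by
    refine intervalIntegral.integral_pos (by norm_num)
      (continuous_eval_mul_weight hα _).continuousOn (fun t ht => ?_)
      ⟨c, Ioo_subset_Icc_self hc, ?_⟩
    · rw [eval_mul]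
      exact mul_nonneg (mul_self_nonneg _) (Real.rpow_nonneg (by nlinarith [ht.1, ht.2]) _)
    · rw [eval_mul]
      exact mul_pos (mul_self_pos.2 hfc) (Real.rpow_pos_of_pos (by nlinarith [hc.1, hc.2]) _)
  exact hpos.ne' h

/-- If `f` is orthogonal to all `X ^ j` with `j < s`, it is orthogonal to all polynomials of
degree less than `s`. -/
theorem ultraInt_mul_eq_zero {α : ℝ} (hα : 0 ≤ α) {s : ℕ} {f : ℝ[X]}
    (hf : ∀ j < s, ultraInt α (f * X ^ j) = 0) {g : ℝ[X]} (hg : g.degree < s) :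
    ultraInt α (f * g) = 0 := by
  let L : ℝ[X] →ₗ[ℝ] ℝ :=
    { toFun := fun g => ultraInt α (f * g)
      map_add' := fun g h => by rw [mul_add, ultraInt_add hα]
      map_smul' := fun c g => by
        rw [smul_eq_C_mul, mul_left_comm, ultraInt_C_mul, RingHom.id_apply, smul_eq_mul] }
  change L g = 0
  by_cases h0 : g = 0
  · rw [h0, map_zero]
  · rw [g.as_sum_range' s ((natDegree_lt_iff_degree_lt h0).2 hg), map_sum]
    refine Finset.sum_eq_zero fun j hj => ?_
    rw [← mul_one (g.coeff j), ← smul_eq_mul, ← smul_monomial, map_smul, monomial_one_right_eq_X_pow]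
    change _ • ultraInt α (f * X ^ j) = 0
    rw [hf j (Finset.mem_range.1 hj), smul_zero]

/-- Recurrence coefficients of the monic Gegenbauer polynomials with parameter `l`. -/
noncomputable def gegCoeff (l : ℝ) (k : ℕ) : ℝ :=
  k * (k + 2 * l - 1) / (4 * (k + l) * (k + l - 1))

/-- The monic Gegenbauer polynomials with parameter `l`. -/
noncomputable def geg (l : ℝ) : ℕ → ℝ[X]
  | 0 => 1
  | 1 => X
  | k + 2 => X * geg l (k + 1) - C (gegCoeff l (k + 1)) * geg l k

theorem geg_add_two (l : ℝ) (k : ℕ) :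
    geg l (k + 2) = X * geg l (k + 1) - C (gegCoeff l (k + 1)) * geg l k := rfl

theorem geg_monic_degree (l : ℝ) (k : ℕ) :
    ((geg l k).Monic ∧ (geg l k).degree = k) ∧
      (geg l (k + 1)).Monic ∧ (geg l (k + 1)).degree = (k + 1 : ℕ) := by
  induction k with
  | zero => simp [geg, monic_X]
  | succ k ih =>
    refine ⟨ih.2, ?_⟩
    have hX : (X * geg l (k + 1)).degree = ((k + 2 : ℕ) : WithBot ℕ) := by
      rw [degree_mul, ih.2.2, degree_X, add_comm]; rfl
    have hlt : (C (gegCoeff l (k + 1)) * geg l k).degree < (X * geg l (k + 1)).degree := by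
      rw [hX]
      rw [← smul_eq_C_mul]
      refine (degree_smul_le _ _).trans_lt ?_
      rw [ih.1.2]
      exact_mod_cast (by omega : k < k + 2)
    rw [geg_add_two]
    exact ⟨(monic_X.mul ih.2.1).sub_of_left hlt, by rw [degree_sub_eq_left_of_degree_lt hlt, hX]⟩

theorem geg_eval_neg (l t : ℝ) (k : ℕ) :
    (geg l k).eval (-t) = (-1) ^ k * (geg l k).eval t ∧
      (geg l (k + 1)).eval (-t) = (-1) ^ (k + 1) * (geg l (k + 1)).eval t := by
  induction k with
  | zero => simp [geg]
  | succ k ih =>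
    refine ⟨ih.2, ?_⟩
    simp only [geg_add_two, eval_sub, eval_mul, eval_X, eval_C, ih.1, ih.2]
    ring

theorem geg_raise {l : ℝ} (hl : 1 ≤ l) (k : ℕ) :
    (1 - X ^ 2) * derivative (geg l k) =
      C (k + 2 * l) * (X * geg l k) - C (2 * (k + l)) * geg l (k + 1) ∧
    (1 - X ^ 2) * derivative (geg l (k + 1)) =
      C ((k + 1 : ℕ) + 2 * l) * (X * geg l (k + 1)) - C (2 * ((k + 1 : ℕ) + l)) * geg l (k + 2) := by
  have key (k : ℕ) : 2 * ((k : ℝ) + 2 + l) * gegCoeff l (k + 2)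
      = 1 + 2 * (k + l) * gegCoeff l (k + 1) := by
    have hk : (0 : ℝ) ≤ k := k.cast_nonneg
    have h1 : (k : ℝ) + 2 + l ≠ 0 := by linarith
    have h2 : (k : ℝ) + 1 + l ≠ 0 := by linarith
    have h3 : (k : ℝ) + l ≠ 0 := by linarith
    have h4 : (k : ℝ) + 2 + l - 1 ≠ 0 := by linarith
    have h5 : (k : ℝ) + 1 + l - 1 ≠ 0 := by linarith
    unfold gegCoeff
    push_cast
    rw [show (k : ℝ) + 2 + l - 1 = k + 1 + l by ring, show (k : ℝ) + 1 + l - 1 = k + l by ring]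
    field_simp
    ring
  induction k with
  | zero =>
    have h1 : l ≠ 0 := by linarith
    have h2 : 1 + l ≠ 0 := by linarith
    have h : 2 * (1 + l) * gegCoeff l 1 = 1 := by
      unfold gegCoeff
      push_cast
      rw [show 1 + l - 1 = l by ring]
      field_simp
      ring
    have h' := congrArg (C : ℝ → ℝ[X]) h
    simp only [geg, Nat.cast_zero, derivative_one, derivative_X, zero_add, C_mul, C_add,
      Nat.cast_one, C_1] at h' ⊢
    constructor
    · ring
    · rw [show (C 2 : ℝ[X]) = 2 from rfl] at h' ⊢
      linear_combination -h'
  | succ k ih =>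
    refine ⟨ih.2, ?_⟩
    have hk := congrArg (C : ℝ → ℝ[X]) (key k)
    have hd : derivative (geg l (k + 2)) = geg l (k + 1) + X * derivative (geg l (k + 1))
        - C (gegCoeff l (k + 1)) * derivative (geg l k) := by
      simp [geg_add_two, derivative_mul]
    have h0 := ih.1
    have h1 := ih.2
    have r1 := geg_add_two l k
    have r2 := geg_add_two l (k + 1)
    simp only [Nat.cast_add, Nat.cast_one, C_add, C_mul, C_1] at h0 h1 hk ⊢
    rw [show k + 1 + 1 = k + 2 from rfl] at r2 ⊢
    rw [show (C 2 : ℝ[X]) = 2 from rfl] at h0 h1 hk ⊢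
    rw [hd]
    linear_combination X * h1 - C (gegCoeff l (k + 1)) * h0 - (C (k : ℝ) + 2 * C l) * X * r1
      + 2 * (C (k : ℝ) + 2 + C l) * r2 - geg l (k + 1) * hk

theorem geg_lower {l : ℝ} (hl : 1 ≤ l) (k : ℕ) :
    (1 - X ^ 2) * derivative (geg l (k + 1)) =
      C (2 * (k + 1 + l) * gegCoeff l (k + 1)) * geg l k - C (k + 1 : ℝ) * (X * geg l (k + 1)) := by
  rw [(geg_raise hl k).2, geg_add_two]
  simp only [Nat.cast_add, Nat.cast_one, C_add, C_mul, C_1]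
  rw [show (C 2 : ℝ[X]) = 2 from rfl]
  ring

/-- Moments of the monic Gegenbauer polynomials satisfy a three-term relation. -/
theorem geg_moment {l : ℝ} (hl : 1 ≤ l) (k j : ℕ) :
    (k + 1 + j + 2 * l + 1) * ultraInt (l - 1 / 2) (geg l (k + 1) * X ^ (j + 1)) =
      2 * (k + 1 + l) * gegCoeff l (k + 1) * ultraInt (l - 1 / 2) (geg l k * X ^ j) +
        j * ultraInt (l - 1 / 2) (geg l (k + 1) * X ^ (j - 1)) := by
  have hα : 0 ≤ l - 1 / 2 := by linarith
  have h := ultraInt_by_parts hα (geg l (k + 1) * X ^ j)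
  have hX : (C (j : ℝ) : ℝ[X]) * X ^ 2 * X ^ (j - 1) = C (j : ℝ) * X ^ (j + 1) := by
    cases j with
    | zero => simp
    | succ j => rw [Nat.add_sub_cancel]; ring
  have e : (1 - X ^ 2) * derivative (geg l (k + 1) * X ^ j)
        - C (2 * (l - 1 / 2 + 1)) * (X * (geg l (k + 1) * X ^ j)) =
      C (2 * (k + 1 + l) * gegCoeff l (k + 1)) * (geg l k * X ^ j) +
        C (j : ℝ) * (geg l (k + 1) * X ^ (j - 1)) -
        C (k + 1 + j + 2 * l + 1) * (geg l (k + 1) * X ^ (j + 1)) := by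
    have h1 := geg_lower hl k
    rw [show 2 * (l - 1 / 2 + 1) = 2 * l + 1 by ring, derivative_mul, derivative_X_pow]
    generalize C (2 * (k + 1 + l) * gegCoeff l (k + 1)) = c at h1 ⊢
    simp only [C_add, C_mul, C_1] at h1 hX ⊢
    linear_combination X ^ j * h1 - geg l (k + 1) * hX
  rw [e, ultraInt_sub hα, ultraInt_add hα, ultraInt_C_mul, ultraInt_C_mul, ultraInt_C_mul] at h
  linarith

theorem geg_orthogonal {l : ℝ} (hl : 1 ≤ l) (k : ℕ) :
    ∀ j < k, ultraInt (l - 1 / 2) (geg l k * X ^ j) = 0 := by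
  have hα : 0 ≤ l - 1 / 2 := by linarith
  induction k using Nat.strong_induction_on with
  | _ k ih =>
  intro j
  induction j using Nat.strong_induction_on with
  | _ j ihj =>
  intro hjk
  match k, j with
  | 1, 0 =>
    have h := ultraInt_by_parts hα 1
    rw [derivative_one, mul_zero, zero_sub, mul_one, ← neg_mul, ← C_neg, ultraInt_C_mul] at h
    have h0 : -(2 * (l - 1 / 2 + 1)) ≠ 0 := by linarith
    simpa [geg] using (mul_eq_zero.1 h).resolve_left h0
  | 2, 0 =>
    have h := geg_moment hl 0 0
    rw [geg_add_two, sub_mul, ultraInt_sub hα, mul_assoc (C _), ultraInt_C_mul]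
    simp only [Nat.cast_zero, zero_add, pow_zero, mul_one, pow_one, zero_mul, add_zero] at h ⊢
    rw [mul_comm X]
    have h1 : 1 + 2 * l + 1 ≠ 0 := by linarith
    apply mul_left_cancel₀ h1
    rw [mul_sub, h]
    ring
  | k + 3, 0 =>
    have h1 := ih (k + 2) (by omega) 1 (by omega)
    have h2 := ih (k + 1) (by omega) 0 (by omega)
    rw [geg_add_two, sub_mul, ultraInt_sub hα, mul_assoc (C _), ultraInt_C_mul, h2]
    rw [pow_zero, mul_one, mul_comm X]
    rw [pow_one] at h1
    rw [show k + 1 + 1 = k + 2 from rfl, h1]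
    ring
  | k + 1, j + 1 =>
    have h := geg_moment hl k j
    rw [ih k (by omega) j (by omega), ihj (j - 1) (by omega) (by omega)] at h
    have h1 : (k : ℝ) + 1 + j + 2 * l + 1 ≠ 0 := by positivity
    simpa [h1] using h

theorem gegCoeff_le {l : ℝ} (hl : 1 ≤ l) {k s : ℕ} (hk : 1 ≤ k) (hks : k < s) :
    4 * gegCoeff l k ≤ 1 - (l - 1) ^ 2 / (s + l - 1) ^ 2 := by
  have hk' : (1 : ℝ) ≤ k := by exact_mod_cast hk
  have hs : (k : ℝ) + 1 ≤ s := by exact_mod_cast hks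
  have e : 4 * gegCoeff l k = 1 - l * (l - 1) / ((k + l) * (k + l - 1)) := by
    have h1 : (k : ℝ) + l ≠ 0 := by linarith
    have h2 : (k : ℝ) + l - 1 ≠ 0 := by linarith
    unfold gegCoeff
    field_simp
    ring
  rw [e]
  have h1 : 0 < (k : ℝ) + l := by linarith
  have h2 : 0 < (k : ℝ) + l - 1 := by linarith
  gcongr
  · nlinarith
  · nlinarith

theorem geg_eval_pos {l t A : ℝ} (ht : 0 < t) (s : ℕ) (hA : 4 * A ≤ t ^ 2)
    (h : ∀ k, 1 ≤ k → k ≤ s → gegCoeff l k ≤ A) :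
    0 < (geg l s).eval t ∧ t / 2 * (geg l s).eval t ≤ (geg l (s + 1)).eval t := by
  induction s with
  | zero => simp [geg]; linarith
  | succ s ih =>
    obtain ⟨h1, h2⟩ := ih fun k hk hks => h k hk (by omega)
    refine ⟨(mul_pos (half_pos ht) h1).trans_le h2, ?_⟩
    have hc := h (s + 1) (by omega) le_rfl
    rw [geg_add_two]
    simp only [eval_sub, eval_mul, eval_X, eval_C]
    have : gegCoeff l (s + 1) * (geg l s).eval t ≤ t / 2 * (t / 2 * (geg l s).eval t) := by
      rw [← mul_assoc]
      gcongr
      linarith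
    have := mul_le_mul_of_nonneg_left h2 (half_pos ht).le
    linarith

theorem IsJacobi.eq_C_mul_geg {l : ℝ} (hl : 1 ≤ l) {s : ℕ} {P : ℝ[X]}
    (hP : IsJacobi (l - 1 / 2) s P) : P = C P.leadingCoeff * geg l s := by
  have hα : 0 ≤ l - 1 / 2 := by linarith
  obtain ⟨hdeg, horth, -⟩ := hP
  have hP0 : P ≠ 0 := by rintro rfl; simp at hdeg
  have hc : P.leadingCoeff ≠ 0 := leadingCoeff_ne_zero.2 hP0
  obtain ⟨hm, hd⟩ := (geg_monic_degree l s).1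
  have hlt : (P - C P.leadingCoeff * geg l s).degree < s := by
    rw [← hdeg]
    refine degree_sub_lt_left ?_ hP0 ?_
    · rw [degree_C_mul hc, hd, hdeg]
    · rw [leadingCoeff_mul, leadingCoeff_C, hm.leadingCoeff, mul_one]
  refine sub_eq_zero.1 (eq_zero_of_ultraInt_sq hα (ultraInt_mul_eq_zero hα (fun j hj => ?_) hlt))
  rw [sub_mul, ultraInt_sub hα, mul_assoc, ultraInt_C_mul, geg_orthogonal hl s j hj, mul_zero,
    sub_zero, ← horth j hj]
  simp [ultraInt]

/-- Estimate (6) on the maximal root: for `n ≥ 4` and `s ≥ 2`,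
`1 - x_s² ≥ (n-4)²/(2s+n-4)²`. -/
theorem maximal_root_upper_bound (n : ℕ) (hn : 4 ≤ n) (s : ℕ) (hs : 2 ≤ s)
    (P : Polynomial ℝ) (hP : IsJacobi (((n : ℝ) - 3) / 2) s P)
    (x : ℝ) (hx : IsGreatest {t : ℝ | P.eval t = 0} x) :
    1 - x ^ 2 ≥ ((n : ℝ) - 4) ^ 2 / (2 * (s : ℝ) + n - 4) ^ 2 := by
  have hn' : (4 : ℝ) ≤ n := by exact_mod_cast hn
  obtain ⟨l, hl⟩ : ∃ l : ℝ, l = ((n : ℝ) - 2) / 2 := ⟨_, rfl⟩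
  have hl1 : 1 ≤ l := by linarith
  rw [show ((n : ℝ) - 3) / 2 = l - 1 / 2 by rw [hl]; ring] at hP
  have hPg := hP.eq_C_mul_geg hl1
  have hc : P.leadingCoeff ≠ 0 := leadingCoeff_ne_zero.2 (by rintro rfl; simp [IsJacobi] at hP)
  have hroot (t : ℝ) : P.eval t = 0 ↔ (geg l s).eval t = 0 := by
    conv_lhs => rw [hPg]
    simp [hc]
  have hx0 : (geg l s).eval x = 0 := (hroot x).1 hx.1
  have hneg : -x ≤ x := hx.2 ((hroot (-x)).2 (by rw [(geg_eval_neg l x s).1, hx0, mul_zero]))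
  have hs' : (2 : ℝ) ≤ s := by exact_mod_cast hs
  have e : ((n : ℝ) - 4) ^ 2 / (2 * (s : ℝ) + n - 4) ^ 2 = (l - 1) ^ 2 / (s + l - 1) ^ 2 := by
    rw [show (n : ℝ) - 4 = 2 * (l - 1) by rw [hl]; ring,
      show 2 * (s : ℝ) + n - 4 = 2 * (s + l - 1) by rw [hl]; ring, mul_pow, mul_pow,
      mul_div_mul_left _ _ (by norm_num)]
  rw [e]
  by_contra! hlt
  have hD : (l - 1) ^ 2 / (s + l - 1) ^ 2 ≤ 1 :=
    div_le_one_of_le₀ (by gcongr; linarith) (by positivity)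
  have hxpos : 0 < x := by
    rcases (by linarith : 0 ≤ x).eq_or_lt with h | h
    · rw [← h] at hlt
      linarith
    · exact h
  obtain ⟨s, rfl⟩ := Nat.exists_eq_add_of_le' (by omega : 1 ≤ s)
  obtain ⟨h1, h2⟩ := geg_eval_pos (l := l) (A := x ^ 2 / 4) hxpos s (by linarith)
    fun k hk hks => by linarith [gegCoeff_le hl1 hk (Nat.lt_succ_of_le hks)]
  rw [hx0] at h2
  exact (mul_pos (half_pos hxpos) h1).not_ge h2
end

section
/- Let n ≥ 3 be an integer, let δ ∈ (−1,1), and let F = Σ_{s=0}^{m} a_s P_s be a real polynomial with a_0 = 1, a_s ≥ 0 for all s, and F(t) ≤ 0 for all t ∈ [−1, δ]. Then ∫_{δ}^{1} F(t)·w(t) dt ≥ ∫_{−1}^{1} w(t) dt. -/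
open Polynomial Set

/-- For `n ≥ 3` the weight is continuous on the whole real line. -/
theorem continuous_jWeight {n : ℕ} (hn : 3 ≤ n) : Continuous (jWeight n) := by
  have hn' : (3 : ℝ) ≤ n := by exact_mod_cast hn
  unfold jWeight
  exact (by fun_prop : Continuous fun t : ℝ => 1 - t ^ 2).rpow_const
    fun _ => Or.inr (by linarith)

/-- The weight is nonnegative on `[-1, 1]`. -/
theorem jWeight_nonneg (n : ℕ) {t : ℝ} (h₁ : -1 ≤ t) (h₂ : t ≤ 1) : 0 ≤ jWeight n t :=
  Real.rpow_nonneg (by nlinarith) _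

/-- The Jacobi polynomial of degree `0` is the constant `1`. -/
theorem IsJacobi.eq_one {α : ℝ} (hα : -1 < α) {P : Polynomial ℝ} (hP : IsJacobi α 0 P) :
    P = 1 := by
  obtain ⟨hdeg, -, heval⟩ := hP
  have hΓ : Real.Gamma (α + 1) ≠ 0 := (Real.Gamma_pos_of_pos (by linarith)).ne'
  have hC := eq_C_of_degree_le_zero hdeg.le
  rw [hC, eval_C] at heval
  rw [hC, heval]
  simp [hΓ]

/-- A Jacobi polynomial of positive degree is orthogonal to the constants. -/
theorem IsJacobi.integral_eq_zero {n s : ℕ} {P : Polynomial ℝ}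
    (hP : IsJacobi (((n : ℝ) - 3) / 2) s P) (hs : 0 < s) :
    ∫ t in (-1 : ℝ)..1, P.eval t * jWeight n t = 0 := by
  simpa [jWeight] using hP.2.1 0 hs

/-- Integrating a Jacobi expansion against the weight leaves only the constant term. -/
theorem integral_sum_jacobi {n : ℕ} (hn : 3 ≤ n) {P : ℕ → Polynomial ℝ}
    (hP : ∀ s, IsJacobi (((n : ℝ) - 3) / 2) s (P s)) (m : ℕ) (a : ℕ → ℝ) :
    ∫ t in (-1 : ℝ)..1,
        (∑ s ∈ Finset.range (m + 1), Polynomial.C (a s) * P s).eval t * jWeight n t =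
      a 0 * ∫ t in (-1 : ℝ)..1, jWeight n t := by
  have hw := continuous_jWeight hn
  have hn' : (3 : ℝ) ≤ n := by exact_mod_cast hn
  simp only [eval_finsetSum, eval_mul, eval_C, Finset.sum_mul, mul_assoc]
  have hint : ∀ s ∈ Finset.range (m + 1), IntervalIntegrable
      (fun t => a s * ((P s).eval t * jWeight n t)) MeasureTheory.volume (-1) 1 := fun s _ =>
    (continuous_const.mul ((P s).continuous.mul hw)).intervalIntegrable _ _
  rw [intervalIntegral.integral_finsetSum hint]
  simp only [intervalIntegral.integral_const_mul]
  rw [Finset.sum_eq_single 0]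
  · simp [(hP 0).eq_one (by linarith)]
  · intro s _ hs
    rw [(hP s).integral_eq_zero (Nat.pos_of_ne_zero hs), mul_zero]
  · simp

/-- First step of the proof of Proposition 1.1: for any admissible `F`,
`∫_δ^1 F(t) w(t) dt ≥ ∫_{-1}^1 w(t) dt`. -/
theorem integral_lower_bound (n : ℕ) (hn : 3 ≤ n)
    (δ : ℝ) (hδ : δ ∈ Set.Ioo (-1 : ℝ) 1)
    (P : ℕ → Polynomial ℝ) (hP : ∀ s, IsJacobi (((n : ℝ) - 3) / 2) s (P s))
    (m : ℕ) (a : ℕ → ℝ) (F : Polynomial ℝ)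
    (hF : F = ∑ s ∈ Finset.range (m + 1), Polynomial.C (a s) * P s)
    (ha0 : a 0 = 1) (ha : ∀ s, 0 ≤ a s)
    (hneg : ∀ t ∈ Set.Icc (-1 : ℝ) δ, F.eval t ≤ 0) :
    (∫ t in δ..1, F.eval t * jWeight n t) ≥ ∫ t in (-1 : ℝ)..1, jWeight n t := by
  have hcont : Continuous fun t => F.eval t * jWeight n t :=
    F.continuous.mul (continuous_jWeight hn)
  have htotal : ∫ t in (-1 : ℝ)..1, F.eval t * jWeight n t = ∫ t in (-1 : ℝ)..1, jWeight n t := by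
    rw [hF, integral_sum_jacobi hn hP m a, ha0, one_mul]
  have hsplit := intervalIntegral.integral_add_adjacent_intervals
    (hcont.intervalIntegrable (μ := MeasureTheory.volume) (-1) δ) (hcont.intervalIntegrable δ 1)
  have hleft : 0 ≤ ∫ t in (-1 : ℝ)..δ, -(F.eval t * jWeight n t) :=
    intervalIntegral.integral_nonneg hδ.1.le fun t ht => neg_nonneg.2 <|
      mul_nonpos_of_nonpos_of_nonneg (hneg t ht) (jWeight_nonneg n ht.1 (ht.2.trans hδ.2.le))
  rw [intervalIntegral.integral_neg] at hleft
  linarith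
end

section
/- Let n ≥ 3 and k ≥ 1 be integers, and let F = Σ_{s=0}^{m} a_s P_s be a real polynomial with F(t) ≥ 0 for all t ∈ [−1,1], F(1) = 1, and a_s ≤ 0 for all s ≥ k. Define G(t) = (F(t) + F(−t))/(F(1) + F(−1)) and write G = Σ_{s=0}^{m} b_s P_s. Then F(1) + F(−1) > 0, G(t) ≥ 0 for all t ∈ [−1,1], G(1) = 1, b_s ≤ 0 for all s ≥ k, b_s = 0 for all odd s, and b_0 ≤ 2·a_0. -/
open Polynomial Set

/-- The linear functional `p ↦ ∫ p(t) (1 - t²)^α dt` over `[-1,1]`, for `α ≥ 0`. -/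
noncomputable def weightedIntegral (α : ℝ) (hα : 0 ≤ α) : ℝ[X] →ₗ[ℝ] ℝ :=
  have hint (p : ℝ[X]) : IntervalIntegrable (fun t => p.eval t * (1 - t ^ 2) ^ α)
      MeasureTheory.volume (-1) 1 :=
    (p.continuous.mul ((continuous_const.sub (continuous_pow 2)).rpow_const
      fun _ => Or.inr hα)).intervalIntegrable _ _
  { toFun := fun p => ∫ t in (-1 : ℝ)..1, p.eval t * (1 - t ^ 2) ^ α
    map_add' := fun p q => by
      simp only [eval_add, add_mul]
      exact intervalIntegral.integral_add (hint p) (hint q)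
    map_smul' := fun c p => by
      simp only [eval_smul, smul_eq_mul, mul_assoc, RingHom.id_apply]
      exact intervalIntegral.integral_const_mul _ _ }

section WeightedIntegral

variable {α : ℝ} {hα : 0 ≤ α}

theorem weightedIntegral_apply (p : ℝ[X]) :
    weightedIntegral α hα p = ∫ t in (-1 : ℝ)..1, p.eval t * (1 - t ^ 2) ^ α := rfl

theorem weightedIntegral_nonneg {p : ℝ[X]} (hp : ∀ t ∈ Icc (-1 : ℝ) 1, 0 ≤ p.eval t) :
    0 ≤ weightedIntegral α hα p := by
  rw [weightedIntegral_apply]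
  refine intervalIntegral.integral_nonneg (by norm_num) fun t ht => ?_
  exact mul_nonneg (hp t ht) (Real.rpow_nonneg (by nlinarith [ht.1, ht.2]) _)

theorem weightedIntegral_mul_self_pos {q : ℝ[X]} (hq : q ≠ 0) :
    0 < weightedIntegral α hα (q * q) := by
  obtain ⟨c, hc, hqc⟩ : ∃ c ∈ Ioo (-1 : ℝ) 1, q.eval c ≠ 0 := by
    by_contra! h
    exact hq (eq_zero_of_infinite_isRoot q ((Ioo_infinite (by norm_num)).mono h))
  rw [weightedIntegral_apply]
  refine intervalIntegral.integral_pos (by norm_num) ?_ (fun t ht => ?_)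
    ⟨c, Ioo_subset_Icc_self hc, ?_⟩
  · exact ((q * q).continuous.mul ((continuous_const.sub (continuous_pow 2)).rpow_const
      fun _ => Or.inr hα)).continuousOn
  · rw [eval_mul]
    exact mul_nonneg (mul_self_nonneg _) (Real.rpow_nonneg (by nlinarith [ht.1, ht.2]) _)
  · rw [eval_mul]
    exact mul_pos (mul_self_pos.2 hqc) (Real.rpow_pos_of_pos (by nlinarith [hc.1, hc.2]) _)

theorem weightedIntegral_comp_neg_X (p : ℝ[X]) :
    weightedIntegral α hα (p.comp (-X)) = weightedIntegral α hα p := by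
  have h := intervalIntegral.integral_comp_neg (a := -1) (b := 1)
    fun t : ℝ => p.eval t * (1 - t ^ 2) ^ α
  simpa [weightedIntegral_apply] using h

theorem weightedIntegral_mul_eq_zero {p q : ℝ[X]} {s : ℕ}
    (hp : ∀ j < s, weightedIntegral α hα (p * X ^ j) = 0) (hq : q.degree < s) :
    weightedIntegral α hα (p * q) = 0 := by
  rw [q.as_sum_support_C_mul_X_pow, Finset.mul_sum, map_sum]
  refine Finset.sum_eq_zero fun i hi => ?_
  have his : i < s := by exact_mod_cast (le_degree_of_mem_supp i hi).trans_lt hq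
  rw [mul_left_comm, ← smul_eq_C_mul, map_smul, hp i his, smul_zero]

theorem IsJacobi.weightedIntegral_mul_eq_zero {s : ℕ} {p q : ℝ[X]} (hp : IsJacobi α s p)
    (hq : q.degree < s) : weightedIntegral α hα (p * q) = 0 := by
  refine _root_.weightedIntegral_mul_eq_zero (fun j hj => ?_) hq
  simpa [weightedIntegral_apply] using hp.2.1 j hj

end WeightedIntegral

theorem coeff_comp_neg_X (p : ℝ[X]) (i : ℕ) :
    (p.comp (-X)).coeff i = (-1) ^ i * p.coeff i := by
  have h : (-X : ℝ[X]) = C (-1) * X := by simp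
  rw [h, comp_C_mul_X_coeff, mul_comm]

theorem IsJacobi.comp_neg_X {α : ℝ} (hα : 0 ≤ α) {s : ℕ} {p : ℝ[X]} (hp : IsJacobi α s p) :
    p.comp (-X) = C ((-1) ^ s) * p := by
  set q := p.comp (-X) - C ((-1) ^ s) * p with hq_def
  have hdeg : q.degree < s := by
    rw [degree_lt_iff_coeff_zero]
    intro i hi
    rw [hq_def, coeff_sub, coeff_C_mul, coeff_comp_neg_X]
    rcases hi.eq_or_lt with rfl | hlt
    · ring
    · rw [coeff_eq_zero_of_degree_lt (hp.1.trans_lt (by exact_mod_cast hlt))]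
      ring
  have hdeg' : (q.comp (-X)).degree < s := by rwa [degree_comp_neg_X]
  by_contra hne
  have hq : q ≠ 0 := sub_ne_zero.2 hne
  have hreflect : weightedIntegral α hα (p.comp (-X) * q) = 0 := by
    rw [← weightedIntegral_comp_neg_X, mul_comp, comp_assoc]
    simpa using hp.weightedIntegral_mul_eq_zero (hα := hα) hdeg'
  refine (weightedIntegral_mul_self_pos (hα := hα) hq).ne' ?_
  conv_lhs => rw [hq_def, sub_mul, ← hq_def]
  rw [map_sub, hreflect, mul_assoc, ← smul_eq_C_mul, map_smul,
    hp.weightedIntegral_mul_eq_zero hdeg, smul_zero, sub_zero]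

theorem IsJacobi.eval_neg {α : ℝ} (hα : 0 ≤ α) {s : ℕ} {p : ℝ[X]} (hp : IsJacobi α s p)
    (t : ℝ) : p.eval (-t) = (-1) ^ s * p.eval t := by
  simpa using congrArg (Polynomial.eval t) (hp.comp_neg_X hα)

theorem IsJacobi.eq_one_s14 {α : ℝ} (hα : 0 ≤ α) {p : ℝ[X]} (hp : IsJacobi α 0 p) : p = 1 := by
  have hC := eq_C_of_degree_eq_zero (p := p) (by simpa using hp.1)
  have h1 := hp.2.2
  rw [hC] at h1 ⊢
  have hΓ : Real.Gamma (α + 1) ≠ 0 := (Real.Gamma_pos_of_pos (by linarith)).ne'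
  simp only [eval_C, Nat.cast_zero, zero_add, Nat.factorial_zero, Nat.cast_one, mul_one,
    div_self hΓ] at h1
  rw [h1, C_1]

theorem IsJacobi.linearIndependent {α : ℝ} {P : ℕ → ℝ[X]} (hP : ∀ s, IsJacobi α s (P s)) :
    LinearIndependent ℝ P :=
  (⟨P, fun s => (hP s).1⟩ : Polynomial.Sequence ℝ).linearIndependent

theorem IsJacobi.coeff_zero_nonneg {α : ℝ} (hα : 0 ≤ α) {P : ℕ → ℝ[X]}
    (hP : ∀ s, IsJacobi α s (P s)) {m : ℕ} {a : ℕ → ℝ}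
    (h : ∀ t ∈ Icc (-1 : ℝ) 1,
      0 ≤ (∑ s ∈ Finset.range (m + 1), C (a s) * P s).eval t) : 0 ≤ a 0 := by
  have hnonneg := weightedIntegral_nonneg (hα := hα) h
  have hone := weightedIntegral_mul_self_pos (hα := hα) (one_ne_zero (α := ℝ[X]))
  rw [mul_one] at hone
  have hvanish : ∀ s, weightedIntegral α hα (P (s + 1)) = 0 := fun s => by
    simpa using (hP (s + 1)).weightedIntegral_mul_eq_zero (hα := hα) (q := 1)
      (by rw [degree_one]; exact_mod_cast s.succ_pos)
  simp only [← smul_eq_C_mul] at hnonneg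
  rw [map_sum, Finset.sum_range_succ', (hP 0).eq_one_s14 hα] at hnonneg
  simp only [map_smul, hvanish, smul_eq_mul, mul_zero, Finset.sum_const_zero, zero_add]
    at hnonneg
  exact nonneg_of_mul_nonneg_left hnonneg hone

/-- Symmetrization step of the proof of Proposition 1.2: for
`G(t) = (F(t)+F(-t))/(F(1)+F(-1))` written as `G = Σ b_s P_s`, one has
`F(1)+F(-1) > 0`, `G ≥ 0` on `[-1,1]`, `G(1) = 1`, `b_s ≤ 0` for `s ≥ k`,
`b_s = 0` for odd `s`, and `b_0 ≤ 2 a_0`. -/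
theorem symmetrization (n : ℕ) (hn : 3 ≤ n) (k : ℕ) (hk : 1 ≤ k)
    (P : ℕ → Polynomial ℝ) (hP : ∀ s, IsJacobi (((n : ℝ) - 3) / 2) s (P s))
    (m : ℕ) (a b : ℕ → ℝ) (F : Polynomial ℝ)
    (hF : F = ∑ s ∈ Finset.range (m + 1), Polynomial.C (a s) * P s)
    (hFpos : ∀ t ∈ Set.Icc (-1 : ℝ) 1, 0 ≤ F.eval t)
    (hF1 : F.eval 1 = 1)
    (hak : ∀ s, k ≤ s → a s ≤ 0)
    (G : ℝ → ℝ)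
    (hG : ∀ t, G t = (F.eval t + F.eval (-t)) / (F.eval 1 + F.eval (-1)))
    (hGb : ∀ t, G t = ∑ s ∈ Finset.range (m + 1), b s * (P s).eval t)
    (hb : ∀ s, m < s → b s = 0) :
    0 < F.eval 1 + F.eval (-1) ∧
    (∀ t ∈ Set.Icc (-1 : ℝ) 1, 0 ≤ G t) ∧
    G 1 = 1 ∧
    (∀ s, k ≤ s → b s ≤ 0) ∧
    (∀ s, Odd s → b s = 0) ∧
    b 0 ≤ 2 * a 0 := by
  have hα : (0 : ℝ) ≤ ((n : ℝ) - 3) / 2 := by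
    have : (3 : ℝ) ≤ n := by exact_mod_cast hn
    linarith
  have hFneg : 0 ≤ F.eval (-1) := hFpos _ (by norm_num)
  have hD : 0 < F.eval 1 + F.eval (-1) := by rw [hF1]; linarith
  have ha0 : 0 ≤ a 0 := IsJacobi.coeff_zero_nonneg hα hP (hF ▸ hFpos)
  have hcoeff : ∀ s ≤ m, b s = a s * (1 + (-1) ^ s) / (F.eval 1 + F.eval (-1)) := by
    set D := F.eval 1 + F.eval (-1)
    have hsum : ∑ s ∈ Finset.range (m + 1), (b s - a s * (1 + (-1) ^ s) / D) • P s = 0 := by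
      refine Polynomial.funext fun t => ?_
      have h := (hGb t).symm.trans (hG t)
      rw [hF, eval_finsetSum, eval_finsetSum, ← Finset.sum_add_distrib, Finset.sum_div,
        ← sub_eq_zero, ← Finset.sum_sub_distrib] at h
      rw [eval_finsetSum, eval_zero, ← h]
      refine Finset.sum_congr rfl fun s _ => ?_
      rw [eval_smul, eval_mul, eval_mul, eval_C, eval_C, (hP s).eval_neg hα, smul_eq_mul]
      ring
    intro s hs
    exact sub_eq_zero.1 (linearIndependent_iff'.1 (IsJacobi.linearIndependent hP) _ _ hsum s
      (Finset.mem_range.2 (Nat.lt_succ_of_le hs)))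
  refine ⟨hD, fun t ht => ?_, ?_, fun s hs => ?_, fun s hs => ?_, ?_⟩
  · rw [hG]
    exact div_nonneg (add_nonneg (hFpos t ht)
      (hFpos (-t) ⟨neg_le_neg ht.2, neg_le.2 ht.1⟩)) hD.le
  · rw [hG, div_self hD.ne']
  · rcases le_or_gt s m with hsm | hsm
    · rw [hcoeff s hsm]
      refine div_nonpos_of_nonpos_of_nonneg (mul_nonpos_of_nonpos_of_nonneg (hak s hs) ?_) hD.le
      rcases neg_one_pow_eq_or ℝ s with h | h <;> rw [h] <;> norm_num
    · exact (hb s hsm).le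
  · rcases le_or_gt s m with hsm | hsm
    · rw [hcoeff s hsm, hs.neg_one_pow, add_neg_cancel, mul_zero, zero_div]
    · exact hb s hsm
  · rw [hcoeff 0 m.zero_le, pow_zero, div_le_iff₀ hD, hF1]
    nlinarith [mul_nonneg ha0 hFneg]
end
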